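/- Let E be the Euclidean space ℝ^d with d ≥ 2, let L ≥ 0 and ε ≥ 0 satisfy L + εL < 1, and let ρ : E → ℝ be a positive L-Lipschitz function. Let x, y, w ∈ E be affinely independent points forming a triangle such that every pair among x, y, w satisfies the empty-disk property: dist(x,y) ≥ min(ρ(x), ρ(y)), dist(x,w) ≥ min(ρ(x), ρ(w)), and dist(y,w) ≥ min(ρ(y), ρ(w)). Let z be the circumcenter of the triangle, and suppose there exists a point v ∈ E such that dist(z,v) ≤ (1+ε)·ρ(z) and dist(z,x) ≤ dist(z,v) (that is, v is no closer to the circumcenter than the circumradius, as happens for a Delaunay triangle whose circumcircle contains no sample point, combined with maximality of the sampling). Then the angle of the triangle at the vertex w satisfies sin(∠xwy) ≥ (1 − L − εL)/(2 + 2ε). -/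

import Mathlib

open EuclideanGeometry

/-- In a nondegenerate triangle, a side is at most twice the sine of the opposite angle times the
distance from the vertices to any point equidistant from them (in the plane of the triangle or
not). -/
theorem EuclideanGeometry.dist_le_two_mul_dist_mul_sin_angle {V P : Type*}
    [NormedAddCommGroup V] [InnerProductSpace ℝ V] [MetricSpace P] [NormedAddTorsor V P]
    {x y w z : P} (h : ¬Collinear ℝ {x, w, y})
    (hzxy : dist z x = dist z y) (hzxw : dist z x = dist z w) :
    dist x y ≤ 2 * dist z x * Real.sin (∠ x w y) := by
  have hsin := sin_pos_of_not_collinear h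
  have ha : 0 < ‖x -ᵥ w‖ := by
    rw [← dist_eq_norm_vsub]
    exact dist_pos.2 (ne₁₂_of_not_collinear h)
  have hb : 0 < ‖y -ᵥ w‖ := by
    rw [← dist_eq_norm_vsub]
    exact dist_pos.2 (ne₂₃_of_not_collinear h).symm
  have hS := InnerProductGeometry.sin_angle_mul_norm_mul_norm (x -ᵥ w) (y -ᵥ w)
  have hxy : dist x y = ‖(x -ᵥ w) - (y -ᵥ w)‖ := by
    rw [vsub_sub_vsub_cancel_right, dist_eq_norm_vsub V]
  have hzx : dist z x = ‖(z -ᵥ w) - (x -ᵥ w)‖ := by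
    rw [vsub_sub_vsub_cancel_right, dist_eq_norm_vsub V]
  have hzy : dist z y = ‖(z -ᵥ w) - (y -ᵥ w)‖ := by
    rw [vsub_sub_vsub_cancel_right, dist_eq_norm_vsub V]
  have hzw : dist z w = ‖z -ᵥ w‖ := dist_eq_norm_vsub V _ _
  have hR : 0 ≤ dist z x := dist_nonneg
  rw [EuclideanGeometry.angle] at hsin ⊢
  rw [hxy]
  rw [hzw] at hzxw
  rw [hzxw] at hzxy hzx hR ⊢
  rw [hzy] at hzxy
  generalize x -ᵥ w = a at *
  generalize y -ᵥ w = b at *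
  generalize z -ᵥ w = c at *
  generalize Real.sin (InnerProductGeometry.angle a b) = s at *
  have hac : inner ℝ a c = ‖a‖ ^ 2 / 2 := by
    have := norm_sub_sq_real c a
    rw [← hzx, real_inner_comm] at this
    linarith
  have hbc : inner ℝ b c = ‖b‖ ^ 2 / 2 := by
    have := norm_sub_sq_real c b
    rw [← hzxy, real_inner_comm] at this
    linarith
  have hD : s ^ 2 * (‖a‖ ^ 2 * ‖b‖ ^ 2) = ‖a‖ ^ 2 * ‖b‖ ^ 2 - inner ℝ a b ^ 2 := by
    have h0 : 0 ≤ ‖a‖ ^ 2 * ‖b‖ ^ 2 - inner ℝ a b ^ 2 := by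
      have := real_inner_mul_inner_self_le a b
      simp only [real_inner_self_eq_norm_sq] at this
      linarith
    have := congrArg (· ^ 2) hS
    simp only [real_inner_self_eq_norm_sq] at this
    rw [Real.sq_sqrt (by linarith)] at this
    linarith
  have hDpos : 0 < ‖a‖ ^ 2 * ‖b‖ ^ 2 - inner ℝ a b ^ 2 := by
    rw [← hD]
    positivity
  have hgram : 0 ≤ (‖a‖ ^ 2 * ‖b‖ ^ 2 - inner ℝ a b ^ 2) *
      (4 * ‖c‖ ^ 2 * (‖a‖ ^ 2 * ‖b‖ ^ 2 - inner ℝ a b ^ 2) -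
        ‖a‖ ^ 2 * ‖b‖ ^ 2 * (‖a‖ ^ 2 - 2 * inner ℝ a b + ‖b‖ ^ 2)) := by
    have h0 := real_inner_self_nonneg (x :=
      (2 * (‖a‖ ^ 2 * ‖b‖ ^ 2 - inner ℝ a b ^ 2)) • c -
        (‖b‖ ^ 2 * (‖a‖ ^ 2 - inner ℝ a b)) • a - (‖a‖ ^ 2 * (‖b‖ ^ 2 - inner ℝ a b)) • b)
    simp only [inner_sub_left, inner_sub_right, real_inner_smul_left, real_inner_smul_right,
      real_inner_comm a c, real_inner_comm b c, real_inner_comm a b, hac, hbc,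
      real_inner_self_eq_norm_sq, norm_smul, mul_pow, Real.norm_eq_abs, sq_abs] at h0
    linear_combination h0
  have hmain := nonneg_of_mul_nonneg_right hgram hDpos
  rw [← hD, ← norm_sub_sq_real] at hmain
  have hle : ‖a - b‖ ^ 2 ≤ (2 * ‖c‖ * s) ^ 2 := by
    have : 0 < ‖a‖ ^ 2 * ‖b‖ ^ 2 := by positivity
    refine le_of_mul_le_mul_left ?_ this
    linarith
  exact le_of_sq_le_sq hle (by positivity)

/-- Lemma 2: angle bound for Delaunay triangles of a near-maximal variable
radius Poisson-disk sampling. -/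
theorem delaunay_angle_bound
    (d : ℕ) (hd : 2 ≤ d)
    (L ε : ℝ) (hL : 0 ≤ L) (hε : 0 ≤ ε) (hLε : L + ε * L < 1)
    (ρ : EuclideanSpace ℝ (Fin d) → ℝ)
    (hρpos : ∀ a, 0 < ρ a)
    (hρlip : ∀ a b, |ρ a - ρ b| ≤ L * dist a b)
    (x y w : EuclideanSpace ℝ (Fin d))
    (hind : AffineIndependent ℝ ![x, y, w])
    (hxy : dist x y ≥ min (ρ x) (ρ y))
    (hxw : dist x w ≥ min (ρ x) (ρ w))
    (hyw : dist y w ≥ min (ρ y) (ρ w))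
    (z : EuclideanSpace ℝ (Fin d))
    (hzxy : dist z x = dist z y) (hzxw : dist z x = dist z w)
    (v : EuclideanSpace ℝ (Fin d))
    (hv : dist z v ≤ (1 + ε) * ρ z) (hvx : dist z x ≤ dist z v) :
    Real.sin (∠ x w y) ≥ (1 - L - ε * L) / (2 + 2 * ε) := by
  have hcol : ¬Collinear ℝ {x, w, y} := by
    rw [affineIndependent_iff_not_collinear_set] at hind
    rwa [Set.pair_comm w y]
  have hside := dist_le_two_mul_dist_mul_sin_angle hcol hzxy hzxw
  have hR : 0 < dist z x := by
    refine dist_pos.2 fun h => ne₁₂_of_not_collinear hcol ?_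
    rw [h, dist_self] at hzxw
    exact dist_eq_zero.1 hzxw.symm
  have hmin : ρ z - L * dist z x ≤ min (ρ x) (ρ y) := by
    have hx := (abs_le.1 (hρlip z x)).2
    have hy := (abs_le.1 (hρlip z y)).2
    rw [← hzxy] at hy
    exact le_min (by linarith) (by linarith)
  have hρz : ρ z ≤ L * dist z x + 2 * dist z x * Real.sin (∠ x w y) := by linarith
  have hscale := mul_le_mul_of_nonneg_left hρz (by linarith : 0 ≤ 1 + ε)
  rw [ge_iff_le, div_le_iff₀ (by linarith)]
  refine le_of_mul_le_mul_left ?_ hR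
  linarith
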